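/- Let d ∈ ℕ, α ∈ (0, min(2,d)) and 0 < β₀ < min(α, d-α). Then there exists a constant c > 0 such that for all β ∈ [β₀, d-α) and all x with 0 < |x| ≤ 1, V_β(x) - κ_β |x|^{-α} ≤ c |x|^{β₀-α}. -/

import Mathlib

open MeasureTheory Real Set Filter RealInnerProductSpace

noncomputable section

/-- Euclidean space `ℝ^d`. -/
abbrev Ed (d : ℕ) := EuclideanSpace ℝ (Fin d)

/-- Modified Bessel function of the second kind `K_ν(r)`. -/
def besselK (ν r : ℝ) : ℝ :=
  (1 / 2) * (r / 2) ^ ν * ∫ u in Ioi (0 : ℝ), u ^ (-ν - 1) * Real.exp (-u - r ^ 2 / (4 * u))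

/-- Relativistic `α`-stable heat kernel with mass parameter `m`:
`p^m(t,x,y) = (2π)^{-d} ∫ exp(-i⟨y-x,z⟩) exp(-t(|z|²+m^{2/α})^{α/2}) dz`
(the integral is real, and equals the cosine integral below). -/
def relKernel (d : ℕ) (α m t : ℝ) (x y : Ed d) : ℝ :=
  (2 * π) ^ (-(d : ℝ)) *
    ∫ z : Ed d, Real.cos ⟪y - x, z⟫ * Real.exp (-t * (‖z‖ ^ 2 + m ^ (2 / α)) ^ (α / 2))

/-- Fractional (`α`-stable) heat kernel `p⁰(t,x,y)`. -/
def fracKernel (d : ℕ) (α t : ℝ) (x y : Ed d) : ℝ :=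
  (2 * π) ^ (-(d : ℝ)) * ∫ z : Ed d, Real.cos ⟪y - x, z⟫ * Real.exp (-t * ‖z‖ ^ α)

/-- The summands of the perturbation series. -/
def pertN (d : ℕ) (k : ℝ → Ed d → Ed d → ℝ) (q : Ed d → ℝ) : ℕ → ℝ → Ed d → Ed d → ℝ
  | 0 => k
  | n + 1 => fun t x y =>
      ∫ s in Ioo (0 : ℝ) t, ∫ z : Ed d, pertN d k q n s x z * q z * k (t - s) z y

/-- Schrödinger perturbation of a transition density `k` by a potential `q`. -/
def pert (d : ℕ) (k : ℝ → Ed d → Ed d → ℝ) (q : Ed d → ℝ) (t : ℝ) (x y : Ed d) : ℝ :=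
  ∑' n : ℕ, pertN d k q n t x y

/-- Radial profile of the potential `V_β`. -/
def VProf (d : ℕ) (α β r : ℝ) : ℝ :=
  2 ^ (α / 2) * Real.Gamma (((d : ℝ) - β) / 2) / Real.Gamma (((d : ℝ) - β - α) / 2) *
    (besselK ((β + α) / 2) r / besselK (β / 2) r) * r ^ (-(α / 2))

/-- The potential `V_β(x)`. -/
def Vbeta (d : ℕ) (α β : ℝ) (x : Ed d) : ℝ := VProf d α β ‖x‖

/-- The Hardy constant `κ_β` for the fractional Laplacian. -/
def kappa (d : ℕ) (α β : ℝ) : ℝ :=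
  2 ^ α * Real.Gamma ((β + α) / 2) * Real.Gamma (((d : ℝ) - β) / 2) /
    (Real.Gamma (β / 2) * Real.Gamma (((d : ℝ) - β - α) / 2))

/-- `h^m_β(x) = ∫_0^∞ t^{(d-α-β)/α} p^m(t,x,0) dt`. -/
def hBetaM (d : ℕ) (α m β : ℝ) (x : Ed d) : ℝ :=
  ∫ t in Ioi (0 : ℝ), t ^ (((d : ℝ) - α - β) / α) * relKernel d α m t x 0

/-- `h_β = h^1_β`. -/
def hBeta (d : ℕ) (α β : ℝ) (x : Ed d) : ℝ := hBetaM d α 1 β x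

/-- `V^m_β(x) = ((d-α-β)/α) h^m_{β+α}(x)/h^m_β(x)`. -/
def VbetaM (d : ℕ) (α m β : ℝ) (x : Ed d) : ℝ :=
  (((d : ℝ) - α - β) / α) * hBetaM d α m (β + α) x / hBetaM d α m β x

/-- The function `H⁰(t,x)`. -/
def Hzero (d : ℕ) (α δ t : ℝ) (x : Ed d) : ℝ :=
  if δ ≤ ((d : ℝ) - α) / 2 then 1 + t ^ (δ / α) * ‖x‖ ^ (-δ)
  else 1 + t ^ (((d : ℝ) - α - δ) / α) * ‖x‖ ^ (-((d : ℝ) - α - δ))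

/-- Density of the Lévy measure of the relativistic `α`-stable operator (mass 1). -/
def levyNu (d : ℕ) (α : ℝ) (x : Ed d) : ℝ :=
  2 ^ ((α - (d : ℝ)) / 2 + 1) * π ^ (-(d : ℝ) / 2) * |Real.Gamma (-α / 2)|⁻¹ *
    besselK (((d : ℝ) + α) / 2) ‖x‖ / ‖x‖ ^ (((d : ℝ) + α) / 2)

/-- The Gamma-like integral. -/
def JJ (ν r : ℝ) : ℝ := ∫ w in Ioi (0 : ℝ), w ^ (ν - 1) * Real.exp (-w - r ^ 2 / (4 * w))

lemma JJ_neg (ν r : ℝ) (hr : 0 < r) :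
    (∫ u in Ioi (0 : ℝ), u ^ (-ν - 1) * Real.exp (-u - r ^ 2 / (4 * u))) =
      (r / 2) ^ (-(2 * ν)) * JJ ν r := by
  have h1 := integral_comp_rpow_Ioi
    (fun u : ℝ => u ^ (-ν - 1) * Real.exp (-u - r ^ 2 / (4 * u))) (p := -1) (by norm_num)
  have ha : 0 < r ^ 2 / 4 := by positivity
  have h2 := integral_comp_mul_left_Ioi
    (fun w : ℝ => w ^ (ν - 1) * Real.exp (-w - r ^ 2 / (4 * w))) 0 ha
  rw [mul_zero] at h2
  have h3 : (r / 2) ^ (-(2 * ν)) = (r ^ 2 / 4) ^ (-ν) := by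
    have : r ^ 2 / 4 = (r / 2) ^ (2 : ℝ) := by
      rw [Real.rpow_two]; ring
    rw [this, ← Real.rpow_mul (by positivity)]; ring_nf
  have h4 : JJ ν r = (r ^ 2 / 4) * ∫ x in Ioi (0 : ℝ),
      (r ^ 2 / 4 * x) ^ (ν - 1) * Real.exp (-(r ^ 2 / 4 * x) - r ^ 2 / (4 * (r ^ 2 / 4 * x))) := by
    rw [h2, smul_eq_mul, ← mul_assoc, mul_inv_cancel₀ ha.ne', one_mul]; rfl
  rw [← h1, h3, h4, ← mul_assoc, ← integral_const_mul]
  refine setIntegral_congr_fun measurableSet_Ioi fun x hx => ?_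
  have hx : 0 < x := hx
  have e1 : x ^ ((-1 : ℝ)) = x⁻¹ := Real.rpow_neg_one x
  have e2 : (-x⁻¹ - r ^ 2 / (4 * x⁻¹)) =
      (-(r ^ 2 / 4 * x) - r ^ 2 / (4 * (r ^ 2 / 4 * x))) := by
    field_simp; ring
  simp only [e1, smul_eq_mul, e2]
  have e3 : |(-1 : ℝ)| * x ^ ((-1 : ℝ) - 1) * x⁻¹ ^ (-ν - 1) = x ^ (ν - 1) := by
    rw [Real.inv_rpow hx.le, ← Real.rpow_neg hx.le, abs_neg, abs_one,
      one_mul, ← Real.rpow_add hx]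
    congr 1; ring
  have e4 : (r ^ 2 / 4) ^ (-ν) * (r ^ 2 / 4) * (r ^ 2 / 4 * x) ^ (ν - 1) = x ^ (ν - 1) := by
    rw [Real.mul_rpow ha.le hx.le, Real.rpow_sub_one ha.ne', Real.rpow_neg ha.le]
    have := Real.rpow_pos_of_pos ha ν
    field_simp
  rw [← mul_assoc, e3, ← mul_assoc ((r ^ 2 / 4) ^ (-ν) * (r ^ 2 / 4)), e4]

lemma JJ_int (ν r : ℝ) (hν : 0 < ν) :
    IntegrableOn (fun w : ℝ => w ^ (ν - 1) * Real.exp (-w - r ^ 2 / (4 * w))) (Ioi 0) := by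
  refine Integrable.mono (Real.GammaIntegral_convergent hν) ?_ ?_
  · exact Measurable.aestronglyMeasurable (by fun_prop)
  · filter_upwards [ae_restrict_mem measurableSet_Ioi] with w hw
    have hw : 0 < w := hw
    rw [Real.norm_of_nonneg (by positivity), Real.norm_of_nonneg (by positivity), mul_comm]
    gcongr
    have : 0 ≤ r ^ 2 / (4 * w) := by positivity
    linarith

lemma Gint (ν : ℝ) (hν : 0 < ν) :
    IntegrableOn (fun w : ℝ => w ^ (ν - 1) * Real.exp (-w)) (Ioi 0) := by
  simpa only [mul_comm] using Real.GammaIntegral_convergent hν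

lemma Geq (ν : ℝ) (hν : 0 < ν) :
    Real.Gamma ν = ∫ w in Ioi (0 : ℝ), w ^ (ν - 1) * Real.exp (-w) := by
  simpa only [mul_comm] using Real.Gamma_eq_integral hν

lemma JJ_le (ν r : ℝ) (hν : 0 < ν) : JJ ν r ≤ Real.Gamma ν := by
  rw [Geq ν hν]
  refine setIntegral_mono_on (JJ_int ν r hν) (Gint ν hν) measurableSet_Ioi fun w hw => ?_
  have hw : 0 < w := hw
  gcongr
  have : 0 ≤ r ^ 2 / (4 * w) := by positivity
  linarith

lemma le_JJ (ν r : ℝ) (hν : 0 < ν) (hr : 0 < r) (hr1 : r ≤ 1) :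
    Real.exp (-3) / 2 ≤ JJ ν r := by
  have h1 : ∫ w in Ioc (1 : ℝ) 2, w ^ (ν - 1) * Real.exp (-w - r ^ 2 / (4 * w)) ≤ JJ ν r := by
    refine setIntegral_mono_set (JJ_int ν r hν) ?_ ?_
    · filter_upwards [ae_restrict_mem measurableSet_Ioi] with w hw
      have hw : 0 < w := hw
      simp only [Pi.zero_apply]
      positivity
    · exact (LE.le.eventuallyLE fun w hw => lt_trans one_pos hw.1)
  refine le_trans ?_ h1
  have h2 : ∫ w in Ioc (1 : ℝ) 2, Real.exp (-3) / 2 ≤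
      ∫ w in Ioc (1 : ℝ) 2, w ^ (ν - 1) * Real.exp (-w - r ^ 2 / (4 * w)) := by
    refine setIntegral_mono_on (by simp) ((JJ_int ν r hν).mono_set
      fun w hw => lt_trans one_pos hw.1) measurableSet_Ioc fun w hw => ?_
    have hw0 : 0 < w := lt_trans one_pos hw.1
    have a1 : (1 / 2 : ℝ) ≤ w ^ (ν - 1) := by
      calc (1 / 2 : ℝ) ≤ w⁻¹ := by
            rw [one_div]; exact inv_anti₀ hw0 hw.2
        _ = w ^ (-1 : ℝ) := (Real.rpow_neg_one w).symm
        _ ≤ _ := Real.rpow_le_rpow_of_exponent_le hw.1.le (by linarith)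
    have a2 : Real.exp (-3) ≤ Real.exp (-w - r ^ 2 / (4 * w)) := by
      gcongr
      have : r ^ 2 / (4 * w) ≤ 1 := by
        rw [div_le_one (by positivity)]
        nlinarith [hw.1]
      linarith [hw.2]
    calc Real.exp (-3) / 2 = 1 / 2 * Real.exp (-3) := by ring
      _ ≤ _ := by gcongr
  refine le_trans (le_of_eq ?_) h2
  simp
  norm_num

/-- pointwise bound -/
lemma one_sub_exp_le (t s : ℝ) (ht : 0 < t) (hs : 0 < s) (hs1 : s ≤ 1) :
    1 - Real.exp (-t) ≤ t ^ s := by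
  have h := Real.add_one_le_exp (-t)
  have h0 := Real.exp_pos (-t)
  rcases le_total t 1 with h1 | h1
  · have := Real.rpow_le_rpow_of_exponent_ge ht h1 hs1
    rw [Real.rpow_one] at this
    linarith
  · have := Real.one_le_rpow h1 hs.le
    linarith

lemma Gdiff (s N : ℝ) (hs : 0 < s) (hs1 : s < 1) (hN : s < N) (ν r : ℝ) (h1 : s ≤ ν) (h2 : ν ≤ N)
    (hr : 0 < r) (hr1 : r ≤ 1) :
    Real.Gamma ν - JJ ν r ≤ (1 / s + 1 / (1 - s) + Real.Gamma (N - s)) * r ^ (2 * s) := by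
  have hν : 0 < ν := by linarith
  have hr2 : 0 < r ^ 2 := by positivity
  have hrs : r ^ (2 * s) = (r ^ 2) ^ s := by
    rw [Real.rpow_mul hr.le, Real.rpow_two]
  set g1 : ℝ → ℝ := (Ioc 0 (r ^ 2)).indicator (fun w => w ^ (s - 1)) with hg1
  set g2 : ℝ → ℝ := (Ioi (r ^ 2)).indicator (fun w => r ^ 2 * w ^ (s - 2)) with hg2
  set g3 : ℝ → ℝ := fun w => r ^ (2 * s) * (w ^ (N - s - 1) * Real.exp (-w)) with hg3
  have i1 : Integrable g1 (volume.restrict (Ioi 0)) := by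
    refine Integrable.mono_measure ?_ Measure.restrict_le_self
    rw [hg1, integrable_indicator_iff measurableSet_Ioc,
      ← intervalIntegrable_iff_integrableOn_Ioc_of_le hr2.le]
    exact intervalIntegral.intervalIntegrable_rpow' (by linarith)
  have i2 : Integrable g2 (volume.restrict (Ioi 0)) := by
    refine Integrable.mono_measure ?_ Measure.restrict_le_self
    rw [hg2, integrable_indicator_iff measurableSet_Ioi]
    exact (integrableOn_Ioi_rpow_of_lt (by linarith) hr2).const_mul _
  have i3 : Integrable g3 (volume.restrict (Ioi 0)) := (Gint (N - s) (by linarith)).const_mul _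
  have e1 : ∫ w in Ioi 0, g1 w = 1 / s * r ^ (2 * s) := by
    rw [hg1, setIntegral_indicator measurableSet_Ioc,
      inter_eq_right.2 (fun w hw => hw.1), ← intervalIntegral.integral_of_le hr2.le,
      integral_rpow (Or.inl (by linarith)), hrs]
    rw [Real.zero_rpow (by linarith)]
    ring_nf
  have e2 : ∫ w in Ioi 0, g2 w = 1 / (1 - s) * r ^ (2 * s) := by
    rw [hg2, setIntegral_indicator measurableSet_Ioi,
      inter_eq_right.2 (Ioi_subset_Ioi hr2.le), integral_const_mul,
      integral_Ioi_rpow_of_lt (by linarith) hr2, hrs]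
    have : (r ^ 2) ^ s = r ^ 2 * (r ^ 2) ^ (s - 2 + 1) := by
      rw [← Real.rpow_one_add' hr2.le (by linarith)]; ring_nf
    rw [this]
    have q : s - 2 + 1 = -(1 - s) := by ring
    rw [q, neg_div_neg_eq]
    ring
  have e3 : ∫ w in Ioi 0, g3 w = Real.Gamma (N - s) * r ^ (2 * s) := by
    rw [hg3, integral_const_mul, ← Geq _ (by linarith)]; ring
  rw [add_mul, add_mul, ← e1, ← e2, ← e3, ← integral_add i1 i2, ← integral_add (f := fun a => g1 a + g2 a) (i1.add i2) i3,
    Geq ν hν, JJ, ← integral_sub (Gint ν hν) (JJ_int ν r hν)]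
  refine setIntegral_mono_on ((Gint ν hν).sub (JJ_int ν r hν)) ((i1.add i2).add i3)
    measurableSet_Ioi fun w hw => ?_
  have hw : 0 < w := hw
  have ht : 0 < r ^ 2 / (4 * w) := by positivity
  set t := r ^ 2 / (4 * w) with htdef
  have htw : t ≤ r ^ 2 / w := by
    rw [htdef]; gcongr; linarith
  have p1 : 1 - Real.exp (-t) ≤ t := by linarith [Real.add_one_le_exp (-t)]
  have p2 : 1 - Real.exp (-t) ≤ 1 := by linarith [Real.exp_pos (-t)]
  have p0 : 0 ≤ 1 - Real.exp (-t) := by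
    have := Real.exp_le_one_iff.2 (show -t ≤ 0 by linarith)
    linarith
  have p3 := one_sub_exp_le t s ht hs hs1.le
  have p4 : t ^ s ≤ r ^ (2 * s) * w ^ (-s) := by
    calc t ^ s ≤ (r ^ 2 / w) ^ s := by gcongr
      _ = _ := by rw [Real.div_rpow hr2.le hw.le, hrs, Real.rpow_neg hw.le]; rfl
  have pe : Real.exp (-w) ≤ 1 := Real.exp_le_one_iff.2 (by linarith)
  have n1 : 0 ≤ g1 w := indicator_nonneg (fun w hw => Real.rpow_nonneg hw.1.le _) _
  have n2 : 0 ≤ g2 w := indicator_nonneg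
    (fun w hw => mul_nonneg hr2.le (Real.rpow_nonneg (lt_trans hr2 hw).le _)) _
  have n3 : 0 ≤ g3 w := by simp only [hg3]; positivity
  have key : w ^ (ν - 1) * Real.exp (-w) - w ^ (ν - 1) * Real.exp (-w - t) =
      w ^ (ν - 1) * Real.exp (-w) * (1 - Real.exp (-t)) := by
    rw [sub_eq_add_neg (-w), Real.exp_add]; ring
  rw [key]
  rcases le_total w 1 with hw1 | hw1
  · have b1 : w ^ (ν - 1) ≤ w ^ (s - 1) :=
      Real.rpow_le_rpow_of_exponent_ge hw hw1 (by linarith)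
    have b2 : w ^ (ν - 1) * Real.exp (-w) * (1 - Real.exp (-t)) ≤
        w ^ (s - 1) * 1 * (1 - Real.exp (-t)) := by gcongr
    suffices w ^ (s - 1) * 1 * (1 - Real.exp (-t)) ≤ g1 w + g2 w by linarith
    rcases le_or_gt w (r ^ 2) with hc | hc
    · have : g1 w = w ^ (s - 1) := indicator_of_mem (show w ∈ Ioc 0 (r ^ 2) from ⟨hw, hc⟩) _
      have : w ^ (s - 1) * 1 * (1 - Real.exp (-t)) ≤ w ^ (s - 1) * 1 * 1 := by gcongr
      linarith
    · have e : g2 w = r ^ 2 * w ^ (s - 2) := indicator_of_mem (show w ∈ Ioi (r ^ 2) from hc) _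
      have : w ^ (s - 1) * 1 * (1 - Real.exp (-t)) ≤ w ^ (s - 1) * 1 * (r ^ 2 / w) := by
        gcongr; linarith
      have e' : w ^ (s - 1) * 1 * (r ^ 2 / w) = r ^ 2 * w ^ (s - 2) := by
        rw [show s - 2 = (s - 1) - 1 by ring, Real.rpow_sub_one hw.ne' (s - 1)]; ring
      linarith
  · have b1 : w ^ (ν - 1) ≤ w ^ (N - 1) :=
      Real.rpow_le_rpow_of_exponent_le hw1 (by linarith)
    have : w ^ (ν - 1) * Real.exp (-w) * (1 - Real.exp (-t)) ≤ 
        w ^ (N - 1) * Real.exp (-w) * (r ^ (2 * s) * w ^ (-s)) := by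
      gcongr; linarith
    have e : g3 w = w ^ (N - 1) * Real.exp (-w) * (r ^ (2 * s) * w ^ (-s)) := by
      simp only [hg3]
      rw [show N - s - 1 = (N - 1) + -s by ring, Real.rpow_add hw]; ring
    linarith

lemma besselK_eq (ν r : ℝ) (hr : 0 < r) :
    besselK ν r = 1 / 2 * (r / 2) ^ (-ν) * JJ ν r := by
  have h2 : 0 < r / 2 := by positivity
  rw [besselK, JJ_neg ν r hr, ← mul_assoc, mul_assoc (1 / 2), ← Real.rpow_add h2]
  congr 3; ring

lemma VProf_eq (d : ℕ) (α β r : ℝ) (hr : 0 < r) :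
    VProf d α β r = 2 ^ α * Real.Gamma (((d : ℝ) - β) / 2) / Real.Gamma (((d : ℝ) - β - α) / 2) *
      (JJ ((β + α) / 2) r / JJ (β / 2) r) * r ^ (-α) := by
  have h2 : 0 < r / 2 := by positivity
  rw [VProf, besselK_eq _ _ hr, besselK_eq _ _ hr]
  have e : (r / 2) ^ (-((β + α) / 2)) = (r / 2) ^ (-(β / 2)) * (2 ^ (α / 2) * r ^ (-(α / 2))) := by
    have : (r / 2) ^ (-(α / 2)) = 2 ^ (α / 2) * r ^ (-(α / 2)) := by
      rw [Real.div_rpow hr.le (by norm_num), Real.rpow_neg (by norm_num : (0:ℝ) ≤ 2), div_inv_eq_mul,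
        mul_comm]
    rw [← this, ← Real.rpow_add h2]; congr 1; ring
  have e1 : (2 : ℝ) ^ α = 2 ^ (α / 2) * 2 ^ (α / 2) := by
    rw [← Real.rpow_add (by norm_num)]; congr 1; ring
  have e2 : r ^ (-α) = r ^ (-(α / 2)) * r ^ (-(α / 2)) := by
    rw [← Real.rpow_add hr]; congr 1; ring
  rw [e, e1, e2]
  have hp := Real.rpow_pos_of_pos h2 (-(β / 2))
  have e3 : 1 / 2 * ((r / 2) ^ (-(β / 2)) * (2 ^ (α / 2) * r ^ (-(α / 2)))) * JJ ((β + α) / 2) r /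
      (1 / 2 * (r / 2) ^ (-(β / 2)) * JJ (β / 2) r) =
      2 ^ (α / 2) * r ^ (-(α / 2)) * (JJ ((β + α) / 2) r / JJ (β / 2) r) := by
    rw [← mul_div_assoc, ← mul_div_mul_left _ (JJ (β / 2) r)
      (c := 1 / 2 * (r / 2) ^ (-(β / 2))) (by positivity)]
    ring
  rw [e3]
  ring

/-- Upper bound of `V_β(x) - κ_β|x|^{-α}` uniform in `β ∈ [β₀, d-α)` (Lemma 2.13). -/
theorem stmt_12 (d : ℕ) (α β₀ : ℝ) (hα : α ∈ Ioo 0 (min 2 (d : ℝ)))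
    (hβ₀ : 0 < β₀) (hβ₀' : β₀ < min α ((d : ℝ) - α)) :
    ∃ c : ℝ, 0 < c ∧ ∀ β : ℝ, β₀ ≤ β → β < (d : ℝ) - α → ∀ x : Ed d,
      0 < ‖x‖ → ‖x‖ ≤ 1 →
        Vbeta d α β x - kappa d α β * ‖x‖ ^ (-α) ≤ c * ‖x‖ ^ (β₀ - α) := by
  obtain ⟨hα0, hα2⟩ := hα
  have hα2' := lt_of_lt_of_le hα2 (min_le_left _ _)
  have hαd := lt_of_lt_of_le hα2 (min_le_right _ _)
  have hβα := lt_of_lt_of_le hβ₀' (min_le_left _ _)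
  have hβd := lt_of_lt_of_le hβ₀' (min_le_right _ _)
  set M : ℝ := max (Real.Gamma (α / 2)) (Real.Gamma ((d : ℝ) / 2)) with hM
  set m : ℝ := Real.exp (-3) / 2 with hm
  have hm0 : 0 < m := by positivity
  have hM0 : 0 < M := lt_of_lt_of_le (Real.Gamma_pos_of_pos (by linarith)) (le_max_left _ _)
  have hMb : ∀ y, α / 2 ≤ y → y ≤ (d : ℝ) / 2 → Real.Gamma y ≤ M := fun y h1 h2 =>
    Real.convexOn_Gamma.le_max_of_mem_Icc (show 0 < α / 2 by linarith)
      (show 0 < (d : ℝ) / 2 by linarith) ⟨h1, h2⟩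
  have hmb : ∀ y, 0 < y → m ≤ Real.Gamma y := fun y hy =>
    (le_JJ y 1 hy one_pos le_rfl).trans (JJ_le y 1 hy)
  set C : ℝ := 1 / (β₀ / 2) + 1 / (1 - β₀ / 2) + Real.Gamma ((d : ℝ) / 2 - β₀ / 2) with hC
  have hC0 : 0 < C := by
    have h1 : 0 < 1 - β₀ / 2 := by linarith
    have h2 : 0 < Real.Gamma ((d : ℝ) / 2 - β₀ / 2) := Real.Gamma_pos_of_pos (by linarith)
    positivity
  refine ⟨2 ^ α * M / m * M * (C / (m * m)), by positivity, fun β hb1 hb2 x hx hx1 => ?_⟩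
  set r := ‖x‖
  rw [Vbeta, VProf_eq _ _ _ _ hx, kappa]
  have hν : 0 < β / 2 := by linarith
  have g1 := hMb (((d : ℝ) - β) / 2) (by linarith) (by linarith)
  have g1' : 0 < Real.Gamma (((d : ℝ) - β) / 2) := Real.Gamma_pos_of_pos (by linarith)
  have g2 := hmb (((d : ℝ) - β - α) / 2) (by linarith)
  have g3 := hMb ((β + α) / 2) (by linarith) (by linarith)
  have g3' : 0 < Real.Gamma ((β + α) / 2) := Real.Gamma_pos_of_pos (by linarith)
  have g4 := hmb (β / 2) hν
  have j1 := JJ_le ((β + α) / 2) r (by linarith)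
  have j2 := le_JJ (β / 2) r hν hx hx1
  have j3 := JJ_le (β / 2) r hν
  have j4 := Gdiff (β₀ / 2) ((d : ℝ) / 2) (by linarith) (by linarith) (by linarith) (β / 2) r
    (by linarith) (by linarith) hx hx1
  rw [← hC, mul_div_cancel₀ _ (two_ne_zero)] at j4
  generalize JJ ((β + α) / 2) r = A at *
  generalize JJ (β / 2) r = B at *
  generalize Real.Gamma (((d : ℝ) - β) / 2) = G1 at *
  generalize Real.Gamma (((d : ℝ) - β - α) / 2) = G2 at *
  generalize Real.Gamma ((β + α) / 2) = G3 at *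
  generalize Real.Gamma (β / 2) = G4 at *
  have hB : 0 < B := lt_of_lt_of_le hm0 j2
  have hG2 : 0 < G2 := lt_of_lt_of_le hm0 g2
  have hG4 : 0 < G4 := lt_of_lt_of_le hm0 g4
  have hsub : 0 ≤ G4 - B := by linarith
  calc 2 ^ α * G1 / G2 * (A / B) * r ^ (-α) - 2 ^ α * G3 * G1 / (G4 * G2) * r ^ (-α)
      ≤ 2 ^ α * G1 / G2 * (G3 / B) * r ^ (-α) - 2 ^ α * G3 * G1 / (G4 * G2) * r ^ (-α) := by
        gcongr
    _ = 2 ^ α * G1 / G2 * G3 * ((G4 - B) / (B * G4)) * r ^ (-α) := by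
        field_simp
    _ ≤ 2 ^ α * M / m * M * (C * r ^ β₀ / (m * m)) * r ^ (-α) := by
        gcongr
    _ = 2 ^ α * M / m * M * (C / (m * m)) * r ^ (β₀ - α) := by
        rw [sub_eq_add_neg β₀, Real.rpow_add hx]; ring
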